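/- arXiv:1805.04894 — 2 statements merged into one kernel-verified Lean document; each statement's English description precedes it below -/
import Mathlib

section
/- The Weierstrass addition formula: for u, v ∈ ℂ with u, v, u±v not in the lattice Λ, ℘(u - v) = (1/4)·((℘'(u) + ℘'(v))/(℘(u) - ℘(v)))² - ℘(u) - ℘(v), provided ℘(u) ≠ ℘(v). -/
/-- The Weierstrass `℘`-function for the lattice `ℤ ⊕ τℤ`. -/
noncomputable def wp (τ u : ℂ) : ℂ :=
  1 / u ^ 2 + ∑' p : ℤ × ℤ,
    if p = 0 then 0
    else 1 / (u + (p.1 : ℂ) * τ + (p.2 : ℂ)) ^ 2 - 1 / ((p.1 : ℂ) * τ + (p.2 : ℂ)) ^ 2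

open Filter Topology PeriodPair

/-- `F` agrees with an analytic function on a punctured neighbourhood of `x`. -/
def RemovableAt (F : ℂ → ℂ) (x c : ℂ) : Prop :=
  ∃ g : ℂ → ℂ, AnalyticAt ℂ g x ∧ F =ᶠ[𝓝[≠] x] g ∧ g x = c

lemma RemovableAt.shift {F : ℂ → ℂ} {x c l : ℂ} (hF : ∀ z, F (z + l) = F z)
    (h : RemovableAt F x c) : RemovableAt F (x + l) c := by
  obtain ⟨g, hg, he, hc⟩ := h
  refine ⟨fun z => g (z - l), ?_, ?_, by simpa using hc⟩
  · have : AnalyticAt ℂ g ((fun z : ℂ => z - l) (x + l)) := by simpa using hg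
    exact this.comp (f := fun z : ℂ => z - l) (by fun_prop)
  · have ht : Tendsto (fun z : ℂ => z - l) (𝓝[≠] (x + l)) (𝓝[≠] x) := by
      refine tendsto_nhdsWithin_of_tendsto_nhds_of_eventually_within _ ?_ ?_
      · have : Tendsto (fun z : ℂ => z - l) (𝓝 (x + l)) (𝓝 (x + l - l)) :=
          (continuous_id.sub continuous_const).tendsto _
        rw [add_sub_cancel_right] at this
        exact this.mono_left nhdsWithin_le_nhds
      · filter_upwards [self_mem_nhdsWithin] with z hz
        intro h
        apply hz
        have h' : z - l = x := h
        simp [← h']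
    filter_upwards [ht.eventually he] with z hz
    rw [← hz, ← hF (z - l), sub_add_cancel]

lemma RemovableAt.limUnder_eq {F : ℂ → ℂ} {x c : ℂ} (h : RemovableAt F x c) :
    limUnder (𝓝[≠] x) F = c := by
  obtain ⟨g, hg, he, hc⟩ := h
  apply Tendsto.limUnder_eq
  rw [tendsto_congr' he, ← hc]
  exact hg.continuousAt.tendsto.mono_left nhdsWithin_le_nhds

lemma RemovableAt.analytic {F : ℂ → ℂ} {x c : ℂ} (h : RemovableAt F x c) :
    AnalyticAt ℂ (fun y => limUnder (𝓝[≠] y) F) x := by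
  obtain ⟨g, hg, he, hc⟩ := h
  refine hg.congr ?_
  have h1 := (eventually_nhdsWithin_iff.mp he).eventually_nhds
  filter_upwards [h1, hg.eventually_analyticAt] with y hy hgy
  symm
  apply RemovableAt.limUnder_eq
  refine ⟨g, hgy, ?_, rfl⟩
  by_cases hyx : y = x
  · subst hyx; exact he
  · have : ∀ᶠ w in 𝓝 y, w ≠ x := isOpen_ne.mem_nhds hyx
    exact (hy.and this).mono (fun w hw => hw.1 hw.2) |>.filter_mono nhdsWithin_le_nhds

lemma RemovableAt.const (L : PeriodPair) {F : ℂ → ℂ}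
    (hF : ∀ z, ∀ l ∈ L.lattice, F (z + l) = F z)
    (h : ∀ x, ∃ c, RemovableAt F x c) {x y c d : ℂ}
    (hx : RemovableAt F x c) (hy : RemovableAt F y d) : c = d := by
  set G : ℂ → ℂ := fun y => limUnder (𝓝[≠] y) F with hG
  have hd : Differentiable ℂ G := fun x => (h x).choose_spec.analytic.differentiableAt
  have hp : ∀ z w, w ∈ L.lattice → G (z + w) = G z := by
    intro z w hw
    obtain ⟨c, hc⟩ := h z
    have := hc.shift (l := w) (fun z => hF z w hw)
    exact this.limUnder_eq.trans hc.limUnder_eq.symm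
  have := hd.apply_eq_apply_of_bounded (IsZLattice.isCompact_range_of_periodic L.lattice _
    hd.continuous hp).isBounded x y
  rw [← hx.limUnder_eq, ← hy.limUnder_eq]
  exact this

lemma RemovableAt.of_analytic {F : ℂ → ℂ} {x : ℂ} (h : AnalyticAt ℂ F x) :
    RemovableAt F x (F x) := ⟨F, h, EventuallyEq.rfl, rfl⟩

section
variable (L : PeriodPair)

lemma wpP_eq (z : ℂ) : ℘[L] z = 1 / z ^ 2 + ℘[L - (0 : ℂ)] z := by
  have := L.weierstrassPExcept_def 0 z
  simp only [ZeroMemClass.coe_zero] at this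
  rw [this]; simp

lemma wpP'_eq (z : ℂ) : ℘'[L] z = - 2 / z ^ 3 + ℘'[L - (0 : ℂ)] z := by
  have := L.derivWeierstrassPExcept_def 0 z
  simp only [ZeroMemClass.coe_zero] at this
  rw [this]; simp; ring

/-- `℘(z) = z⁻² + 3 G₄ z² + z³ r(z)`. -/
lemma wpP_expand : ∃ r : ℂ → ℂ, AnalyticAt ℂ r 0 ∧
    ∀ z, ℘[L - (0 : ℂ)] z = z ^ 2 * (3 * L.G 4) + z ^ 3 * r z := by
  obtain ⟨r, hr, h⟩ := (L.analyticAt_weierstrassPExcept 0).exists_eq_sum_add_pow_mul 3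
  refine ⟨r, hr, fun z => ?_⟩
  rw [h z]
  simp [Finset.sum_range_succ, iteratedDeriv_weierstrassPExcept_self, Nat.factorial,
    L.G_eq_zero_of_odd 3 (by decide), -iteratedDeriv_one, -iteratedDeriv_zero]
  ring

lemma eventually_notMem : ∀ᶠ z in 𝓝[≠] (0 : ℂ), z ∉ L.lattice := by
  filter_upwards [self_mem_nhdsWithin, mem_nhdsWithin_of_mem_nhds
    (L.compl_lattice_sdiff_singleton_mem_nhds 0)] with z hz hz'
  simp_all

lemma deriv_wpP'_eq : ∀ᶠ z in 𝓝[≠] (0 : ℂ),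
    deriv ℘'[L] z = 6 / z ^ 4 + deriv ℘'[L - (0 : ℂ)] z := by
  filter_upwards [self_mem_nhdsWithin, mem_nhdsWithin_of_mem_nhds
    (L.analyticAt_derivWeierstrassPExcept 0).eventually_analyticAt] with z hz hz'
  have hz0 : z ≠ 0 := hz
  have h1 : HasDerivAt (fun z : ℂ => - 2 / z ^ 3) (6 / z ^ 4) z := by
    have := (hasDerivAt_const z (-2 : ℂ)).div (hasDerivAt_pow 3 z) (pow_ne_zero 3 hz0)
    convert! this using 1
    push_cast
    field_simp
    ring
  have h2 := h1.add hz'.differentiableAt.hasDerivAt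
  rw [show ℘'[L] = (fun z : ℂ => - 2 / z ^ 3) + ℘'[L - (0 : ℂ)] from funext (wpP'_eq L)]
  exact h2.deriv

lemma second_deriv (z : ℂ) (hz : z ∉ L.lattice) :
    deriv ℘'[L] z = 6 * ℘[L] z ^ 2 - L.g₂ / 2 := by
  set F : ℂ → ℂ := fun z => deriv ℘'[L] z - 6 * ℘[L] z ^ 2 with hF
  have hper : ∀ z, ∀ l ∈ L.lattice, F (z + l) = F z := by
    intro z l hl
    have h1 : ℘[L] (z + l) = ℘[L] z := L.weierstrassP_add_coe z ⟨l, hl⟩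
    have h2 : deriv ℘'[L] (z + l) = deriv ℘'[L] z := by
      rw [← deriv_comp_add_const]
      congr 1
      funext w
      exact L.derivWeierstrassP_add_coe w ⟨l, hl⟩
    simp only [hF, h1, h2]
  have hreg : ∀ z, z ∉ L.lattice → RemovableAt F z (F z) := by
    intro z hz
    apply RemovableAt.of_analytic
    have h1 := (L.analyticOnNhd_derivWeierstrassP z hz).deriv
    have h2 := L.analyticOnNhd_weierstrassP z hz
    fun_prop
  have h0 : RemovableAt F 0 (- L.g₂ / 2) := by
    obtain ⟨r, hr, h⟩ := wpP_expand L
    refine ⟨fun z => deriv ℘'[L - (0 : ℂ)] z - 12 * (3 * L.G 4 + z * r z)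
      - 6 * ℘[L - (0 : ℂ)] z ^ 2, ?_, ?_, ?_⟩
    · have h1 := (L.analyticAt_derivWeierstrassPExcept 0).deriv
      fun_prop
    · filter_upwards [self_mem_nhdsWithin, deriv_wpP'_eq L] with z hz hz'
      have hz0 : z ≠ 0 := hz
      simp only [hF]
      rw [hz', wpP_eq, h]
      field_simp
      ring
    · simp [g₂, L.sumInvPow_zero]; ring
  have hall : ∀ x, ∃ c, RemovableAt F x c := by
    intro x
    by_cases hx : x ∈ L.lattice
    · have := h0.shift (l := x) (fun z => hper z x hx)
      rw [zero_add] at this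
      exact ⟨_, this⟩
    · exact ⟨_, hreg x hx⟩
  have := RemovableAt.const L hper hall (hreg z hz) h0
  simp only [hF] at this
  linear_combination this

end

section
variable (L : PeriodPair)

lemma shifted_expand (v : ℂ) (hv : v ∉ L.lattice) : ∃ r : ℂ → ℂ, AnalyticAt ℂ r 0 ∧
    ∀ z, ℘[L] (z - v) = ℘[L] v - z * ℘'[L] v + z ^ 2 * (3 * ℘[L] v ^ 2 - L.g₂ / 4)
      - z ^ 3 * (2 * ℘[L] v * ℘'[L] v) + z ^ 4 * r z := by
  have hv' : -v ∉ L.lattice := by simpa using hv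
  have ha : AnalyticAt ℂ (fun z => ℘[L] (z - v)) 0 := by
    have : AnalyticAt ℂ ℘[L] ((fun z : ℂ => z - v) 0) := by
      simpa using L.analyticOnNhd_weierstrassP (-v) hv'
    exact this.comp (f := fun z : ℂ => z - v) (by fun_prop)
  obtain ⟨r, hr, h⟩ := ha.exists_eq_sum_add_pow_mul 4
  refine ⟨r, hr, fun z => ?_⟩
  have hs : ∀ n, iteratedDeriv n (fun z => ℘[L] (z - v)) 0 = iteratedDeriv n ℘[L] (-v) := by
    intro n
    rw [iteratedDeriv_comp_sub_const]
    simp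
  have d0 : iteratedDeriv 0 ℘[L] (-v) = ℘[L] v := by simp
  have d1 : iteratedDeriv 1 ℘[L] (-v) = - ℘'[L] v := by simp
  have d2 : iteratedDeriv 2 ℘[L] (-v) = 6 * ℘[L] v ^ 2 - L.g₂ / 2 := by
    rw [iteratedDeriv_succ, iteratedDeriv_one, deriv_weierstrassP, second_deriv L _ hv',
      weierstrassP_neg]
  have d3 : iteratedDeriv 3 ℘[L] (-v) = - (12 * ℘[L] v * ℘'[L] v) := by
    rw [iteratedDeriv_succ, iteratedDeriv_succ, iteratedDeriv_one, deriv_weierstrassP]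
    have : deriv ℘'[L] =ᶠ[𝓝 (-v)] fun z => 6 * ℘[L] z ^ 2 - L.g₂ / 2 := by
      filter_upwards [L.isClosed_lattice.isOpen_compl.mem_nhds hv'] with z hz
      exact second_deriv L z hz
    rw [this.deriv_eq]
    have h1 : HasDerivAt ℘[L] (℘'[L] (-v)) (-v) := by
      rw [← deriv_weierstrassP]
      exact (L.analyticOnNhd_weierstrassP (-v) hv').differentiableAt.hasDerivAt
    have h2 := ((h1.pow 2).const_mul 6).sub_const (L.g₂ / 2)
    refine h2.deriv.trans ?_
    simp
    ring
  rw [h z]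
  simp only [hs, Finset.sum_range_succ, Finset.sum_range_zero, d0, d1, d2, d3, smul_eq_mul,
    Nat.factorial]
  push_cast
  ring

lemma add_poly (u v : ℂ) (hu : u ∉ L.lattice) (hv : v ∉ L.lattice) (huv : u - v ∉ L.lattice) :
    (℘[L] (u - v) + ℘[L] u + ℘[L] v) * (℘[L] u - ℘[L] v) ^ 2
      = (1 / 4) * (℘'[L] u + ℘'[L] v) ^ 2 := by
  set F : ℂ → ℂ := fun z => (℘[L] (z - v) + ℘[L] z + ℘[L] v) * (℘[L] z - ℘[L] v) ^ 2
      - (1 / 4) * (℘'[L] z + ℘'[L] v) ^ 2 with hF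
  have hper : ∀ z, ∀ l ∈ L.lattice, F (z + l) = F z := by
    intro z l hl
    have h1 : ∀ z, ℘[L] (z + l) = ℘[L] z := fun z => L.weierstrassP_add_coe z ⟨l, hl⟩
    have h2 : ℘'[L] (z + l) = ℘'[L] z := L.derivWeierstrassP_add_coe z ⟨l, hl⟩
    have h3 : z + l - v = z - v + l := by ring
    simp only [hF, h3, h1, h2]
  have hreg : ∀ z, z ∉ L.lattice → z - v ∉ L.lattice → RemovableAt F z (F z) := by
    intro z hz hzv
    apply RemovableAt.of_analytic
    have h1 := L.analyticOnNhd_derivWeierstrassP z hz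
    have h2 := L.analyticOnNhd_weierstrassP z hz
    have h3 : AnalyticAt ℂ (fun z => ℘[L] (z - v)) z :=
      (L.analyticOnNhd_weierstrassP (z - v) hzv).comp (f := fun z : ℂ => z - v) (by fun_prop)
    fun_prop
  have h0 : ∃ c, RemovableAt F 0 c := by
    obtain ⟨r, hr, h⟩ := wpP_expand L
    obtain ⟨s, hs, hsv⟩ := shifted_expand L v hv
    set e := ℘[L] v
    set e' := ℘'[L] v
    let A₁ : ℂ → ℂ := fun z => - e' + z * (3 * e ^ 2 - L.g₂ / 4) - z ^ 2 * (2 * e * e') + z ^ 3 * s z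
    let Q : ℂ → ℂ := fun z => 3 * L.G 4 + z * r z
    let B : ℂ → ℂ := fun z => L.g₂ / 4 - 3 * e ^ 2 - 2 * e * (z * A₁ z)
    let N : ℂ → ℂ := fun z => s z - 2 * e * ((3 * e ^ 2 - L.g₂ / 4) - z * (2 * e * e') + z ^ 2 * s z)
    refine ⟨_, fun z => N z + 2 * Q z * (z * A₁ z) + (z * A₁ z) * (z ^ 2 * Q z) ^ 2
      + B z * (z ^ 2 * Q z) - e' / 2 * ℘'[L - (0 : ℂ)] z
      + (z * A₁ z + e) * e ^ 2 + e ^ 3 + L.g₃ / 4 - e' ^ 2 / 4, ?_, ?_, rfl⟩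
    · simp only [N, Q, A₁, B]
      fun_prop
    · filter_upwards [self_mem_nhdsWithin, eventually_notMem L] with z hz hz'
      have hz0 : z ≠ 0 := hz
      have hode := L.derivWeierstrassP_sq z hz'
      have hq := (wpP_eq L z).trans (congrArg (1 / z ^ 2 + ·) (h z))
      have hq' := wpP'_eq L z
      have hA : ℘[L] (z - v) = e + z * A₁ z := by rw [hsv z]; simp only [A₁]; ring
      have key : F z = (z * A₁ z) * ℘[L] z ^ 2 + B z * ℘[L] z - e' / 2 * ℘'[L] z
          + (z * A₁ z + e) * e ^ 2 + e ^ 3 + L.g₃ / 4 - e' ^ 2 / 4 := by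
        simp only [hF, hA, B]
        linear_combination (- 1 / 4) * hode
      rw [key, hq, hq']
      have hN : A₁ z / z ^ 3 + B z / z ^ 2 + e' / z ^ 3 = N z := by
        simp only [N, B, A₁]
        field_simp
        ring
      rw [← hN]
      simp only [Q]
      field_simp
      ring
  have hvv : RemovableAt F v 0 := by
    have h1 := L.analyticOnNhd_derivWeierstrassP v hv
    have h2 := L.analyticOnNhd_weierstrassP v hv
    have h3 : AnalyticAt ℂ (dslope ℘[L] v) v := by
      obtain ⟨p, hp⟩ := h2
      exact ⟨_, hp.has_fpower_series_dslope_fslope⟩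
    have h4 : AnalyticAt ℂ (fun z => ℘[L - (0 : ℂ)] (z - v)) v := by
      have : AnalyticAt ℂ ℘[L - (0 : ℂ)] ((fun z : ℂ => z - v) v) := by
        simpa using L.analyticAt_weierstrassPExcept 0
      exact this.comp (f := fun z : ℂ => z - v) (by fun_prop)
    refine ⟨fun z => dslope ℘[L] v z ^ 2 +
      (℘[L - (0 : ℂ)] (z - v) + ℘[L] z + ℘[L] v) * (℘[L] z - ℘[L] v) ^ 2
      - (1 / 4) * (℘'[L] z + ℘'[L] v) ^ 2, by fun_prop, ?_, ?_⟩
    · filter_upwards [self_mem_nhdsWithin] with z hz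
      have hz0 : z - v ≠ 0 := sub_ne_zero.mpr hz
      have hs : ℘[L] z - ℘[L] v = (z - v) * dslope ℘[L] v z := by
        have := sub_smul_dslope ℘[L] v z
        simpa using this.symm
      simp only [hF]
      rw [wpP_eq L (z - v), hs]
      field_simp
      ring
    · simp
      ring
  have hall : ∀ x, ∃ c, RemovableAt F x c := by
    intro x
    by_cases hx : x ∈ L.lattice
    · obtain ⟨c, hc⟩ := h0
      have := hc.shift (l := x) (fun z => hper z x hx)
      rw [zero_add] at this
      exact ⟨_, this⟩
    by_cases hxv : x - v ∈ L.lattice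
    · have := hvv.shift (l := x - v) (fun z => hper z _ hxv)
      rw [add_sub_cancel] at this
      exact ⟨_, this⟩
    · exact ⟨_, hreg x hx hxv⟩
  have := RemovableAt.const L hper hall (hreg u hu huv) hvv
  simp only [hF] at this
  linear_combination this

end

lemma indep_tau (τ : ℂ) (hτ : 0 < τ.im) : LinearIndependent ℝ ![τ, 1] := by
  rw [LinearIndependent.pair_iff]
  intro s t h
  have him := congrArg Complex.im h
  have hre := congrArg Complex.re h
  simp at him hre
  have hs : s = 0 := by
    rcases him with h | h
    · exact h
    · exact absurd h hτ.ne'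
  subst hs
  simpa using hre

lemma wp_eq_weierstrassP (L : PeriodPair) (τ : ℂ) (h1 : L.ω₁ = τ) (h2 : L.ω₂ = 1) :
    wp τ = ℘[L] := by
  funext u
  rw [wpP_eq L u, wp]
  congr 1
  have hn : ℘[L - (0 : ℂ)] u = ℘[L - (0 : ℂ)] (-u) := by
    rw [weierstrassPExcept_neg, neg_zero]
  rw [hn, weierstrassPExcept, ← L.latticeEquivProd.symm.toEquiv.tsum_eq]
  congr 1
  funext p
  have hp : ((L.latticeEquivProd.symm p : L.lattice) : ℂ) = p.1 * τ + p.2 := by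
    rw [L.latticeEquiv_symm_apply, h1, h2, mul_one]
  have hp0 : ((L.latticeEquivProd.symm p : L.lattice) : ℂ) = 0 ↔ p = 0 := by
    simp
  have e : L.latticeEquivProd.symm.toEquiv p = L.latticeEquivProd.symm p := rfl
  rw [e]
  simp only [hp0]
  split_ifs
  · rfl
  · rw [hp]
    congr 2
    ring

/-- The Weierstrass addition formula: for `u, v ∈ ℂ` with
`u, v, u+v, u-v` not in the lattice `Λ = ℤ ⊕ τℤ` and `℘(u) ≠ ℘(v)`, one has
`℘(u - v) = (1/4)((℘'(u) + ℘'(v))/(℘(u) - ℘(v)))² - ℘(u) - ℘(v)`. -/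
theorem wp_addition_formula (τ : ℂ) (hτ : 0 < τ.im) (u v : ℂ)
    (hu : ∀ m n : ℤ, u ≠ (m : ℂ) * τ + (n : ℂ))
    (hv : ∀ m n : ℤ, v ≠ (m : ℂ) * τ + (n : ℂ))
    (huv : ∀ m n : ℤ, u + v ≠ (m : ℂ) * τ + (n : ℂ))
    (huv' : ∀ m n : ℤ, u - v ≠ (m : ℂ) * τ + (n : ℂ))
    (hne : wp τ u ≠ wp τ v) :
    wp τ (u - v) =
      (1 / 4) * ((deriv (wp τ) u + deriv (wp τ) v) / (wp τ u - wp τ v)) ^ 2 -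
        wp τ u - wp τ v := by
  let L : PeriodPair := ⟨τ, 1, indep_tau τ hτ⟩
  have hmem : ∀ x : ℂ, (∀ m n : ℤ, x ≠ (m : ℂ) * τ + (n : ℂ)) → x ∉ L.lattice := by
    intro x hx hxL
    obtain ⟨m, n, h⟩ := PeriodPair.mem_lattice.mp hxL
    apply hx m n
    rw [← h]
    simp [L]
  have hwp : wp τ = ℘[L] := wp_eq_weierstrassP L τ rfl rfl
  rw [hwp] at hne ⊢
  have h := add_poly L u v (hmem u hu) (hmem v hv) (hmem _ huv')
  rw [deriv_weierstrassP]
  have hd : ℘[L] u - ℘[L] v ≠ 0 := sub_ne_zero.mpr hne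
  rw [div_pow, ← mul_div_assoc, ← h, mul_div_cancel_right₀ _ (pow_ne_zero 2 hd)]
  ring
end

section
/- The half-period values of ℘ are expressed in theta constants: ℘(1/2, τ) = (π²/3)(θ₃(τ)⁴ + θ₄(τ)⁴), ℘(τ/2, τ) = -(π²/3)(θ₂(τ)⁴ + θ₃(τ)⁴), and ℘((1+τ)/2, τ) = (π²/3)(θ₂(τ)⁴ - θ₄(τ)⁴). -/
/-- The theta constant `θ₂(τ) = Σ_{n∈ℤ} q^{(n+1/2)²/2}`, `q = e^{2πiτ}`. -/
noncomputable def theta2 (τ : ℂ) : ℂ :=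
  ∑' n : ℤ, Complex.exp ((Real.pi : ℂ) * Complex.I * τ * ((n : ℂ) + 1 / 2) ^ 2)

/-- The theta constant `θ₃(τ) = Σ_{n∈ℤ} q^{n²/2}`, `q = e^{2πiτ}`. -/
noncomputable def theta3 (τ : ℂ) : ℂ :=
  ∑' n : ℤ, Complex.exp ((Real.pi : ℂ) * Complex.I * τ * (n : ℂ) ^ 2)

/-- The theta constant `θ₄(τ) = Σ_{n∈ℤ} (-1)ⁿ q^{n²/2}`, `q = e^{2πiτ}`. -/
noncomputable def theta4 (τ : ℂ) : ℂ :=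
  ∑' n : ℤ, (-1 : ℂ) ^ n * Complex.exp ((Real.pi : ℂ) * Complex.I * τ * (n : ℂ) ^ 2)

section HalfPeriodProof
open Complex Filter Topology

section PartA
open UpperHalfPlane ModularForm MatrixGroups ModularGroup SlashInvariantForm in
lemma hp_cusp_zero (F : ℂ → ℂ) (k : ℕ) (hk : k < 12)
    (hd : DifferentiableOn ℂ F {z | 0 < z.im})
    (hT : ∀ τ : ℂ, 0 < τ.im → F (τ + 1) = F τ)
    (hS : ∀ τ : ℂ, 0 < τ.im → F (-1 / τ) = τ ^ k * F τ)
    (hlim : Tendsto F (comap Complex.im atTop) (𝓝 0)) :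
    ∀ τ : ℂ, 0 < τ.im → F τ = 0 := by
  have hT' : ((fun z : ℍ ↦ F z) ∣[(k : ℤ)] ModularGroup.T) = fun z : ℍ ↦ F z := by
    ext z
    have h1 : denom (ModularGroup.T : SL(2, ℤ)) z = 1 := by
      rw [denom_apply]; simp [ModularGroup.T]
    have := hT z z.2
    rw [SL_slash_apply, h1, modular_T_smul]
    simp [add_comm] at this ⊢
    rw [this]
  have hS' : ((fun z : ℍ ↦ F z) ∣[(k : ℤ)] ModularGroup.S) = fun z : ℍ ↦ F z := by
    ext z
    have hz : (z : ℂ) ^ k ≠ 0 := pow_ne_zero _ (UpperHalfPlane.ne_zero z)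
    have := hS z z.2
    suffices F (-(↑z)⁻¹) * ((z : ℂ) ^ k)⁻¹ = F z by
      rw [SL_slash_apply, UpperHalfPlane.modular_S_smul]
      simpa [ModularGroup.denom_S]
    rw [neg_div, one_div] at this
    rw [this]
    field_simp
  have hlim' : IsZeroAtImInfty (fun z : ℍ ↦ F z) := by
    refine hlim.comp ?_
    rw [tendsto_comap_iff]
    exact tendsto_comap
  let f : CuspForm 𝒮ℒ (k : ℤ) :=
    { toFun := fun z : ℍ ↦ F z
      slash_action_eq' := by
        intro A hA
        obtain ⟨A, rfl⟩ := hA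
        exact slash_action_generators_SL2Z hS' hT' A
      holo' := by
        rw [UpperHalfPlane.mdifferentiable_iff]
        refine hd.congr fun z hz ↦ ?_
        simp [ofComplex_apply_of_im_pos hz]
      zero_at_cusps' := by
        intro c hc
        rw [Subgroup.IsArithmetic.isCusp_iff_isCusp_SL2Z] at hc
        rw [OnePoint.isZeroAt_iff_forall_SL2Z hc]
        intro γ _
        rw [slash_action_generators_SL2Z hS' hT']
        exact hlim' }
  have hf : f = 0 := rank_zero_iff_forall_zero.mp
    (CuspForm.rank_eq_zero_of_weight_lt_twelve (by exact_mod_cast hk)) f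
  intro τ hτ
  have := DFunLike.congr_fun hf (⟨τ, hτ⟩ : ℍ)
  exact this

lemma hp_triple_zero (A B C : ℂ → ℂ)
    (hA : DifferentiableOn ℂ A {z | 0 < z.im})
    (hB : DifferentiableOn ℂ B {z | 0 < z.im})
    (hC : DifferentiableOn ℂ C {z | 0 < z.im})
    (lA : Tendsto A (comap Complex.im atTop) (𝓝 0))
    (lB : Tendsto B (comap Complex.im atTop) (𝓝 0))
    (lC : Tendsto C (comap Complex.im atTop) (𝓝 0))
    (tA : ∀ τ : ℂ, 0 < τ.im → A (τ + 1) = A τ)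
    (tB : ∀ τ : ℂ, 0 < τ.im → B (τ + 1) = C τ)
    (tC : ∀ τ : ℂ, 0 < τ.im → C (τ + 1) = B τ)
    (sA : ∀ τ : ℂ, 0 < τ.im → A (-1 / τ) = τ ^ 2 * B τ)
    (sB : ∀ τ : ℂ, 0 < τ.im → B (-1 / τ) = τ ^ 2 * A τ)
    (sC : ∀ τ : ℂ, 0 < τ.im → C (-1 / τ) = τ ^ 2 * C τ) :
    ∀ τ : ℂ, 0 < τ.im → A τ = 0 ∧ B τ = 0 ∧ C τ = 0 := by
  have key : ∀ j : ℕ, 1 ≤ j → j ≤ 3 → ∀ τ : ℂ, 0 < τ.im →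
      A τ ^ j + B τ ^ j + C τ ^ j = 0 := by
    intro j hj hj3
    refine hp_cusp_zero (fun τ ↦ A τ ^ j + B τ ^ j + C τ ^ j) (2 * j) (by omega)
      (((hA.pow j).add (hB.pow j)).add (hC.pow j)) ?_ ?_ ?_
    · intro τ hτ
      simp only [tA τ hτ, tB τ hτ, tC τ hτ]
      ring
    · intro τ hτ
      simp only [sA τ hτ, sB τ hτ, sC τ hτ, mul_pow, ← pow_mul]
      ring
    · have := ((lA.pow j).add (lB.pow j)).add (lC.pow j)
      simpa [show j ≠ 0 by omega] using this
  intro τ hτ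
  have h1 := key 1 (by norm_num) (by norm_num) τ hτ
  have h2 := key 2 (by norm_num) (by norm_num) τ hτ
  have h3 := key 3 (by norm_num) (by norm_num) τ hτ
  simp only [pow_one] at h1
  generalize A τ = a at *
  generalize B τ = b at *
  generalize C τ = c at *
  have hc : c = -a - b := by linear_combination h1
  subst hc
  have e2 : a ^ 2 + a * b + b ^ 2 = 0 := by linear_combination h2 / 2
  have e3 : a * b * (a + b) = 0 := by linear_combination -h3 / 3
  have a3 : a ^ 3 = 0 := by linear_combination a * e2 - e3
  have b3 : b ^ 3 = 0 := by linear_combination b * e2 - e3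
  have ha : a = 0 := by simpa using a3
  have hb : b = 0 := by simpa using b3
  simp [ha, hb]
end PartA

section PartB

lemma hp_theta3_eq (τ : ℂ) : theta3 τ = jacobiTheta₂ 0 τ := by
  unfold theta3 jacobiTheta₂ jacobiTheta₂_term
  refine tsum_congr fun n ↦ ?_
  congr 1
  ring

lemma hp_theta4_eq (τ : ℂ) : theta4 τ = jacobiTheta₂ (1 / 2) τ := by
  unfold theta4 jacobiTheta₂ jacobiTheta₂_term
  refine tsum_congr fun n ↦ ?_
  rw [Complex.exp_add, show (2 * (Real.pi : ℂ) * I * n * (1 / 2)) = n * (Real.pi * I) by ring,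
    Complex.exp_int_mul, Complex.exp_pi_mul_I]
  congr 2
  ring

lemma hp_theta2_eq (τ : ℂ) :
    theta2 τ = cexp ((Real.pi : ℂ) * I * τ / 4) * jacobiTheta₂ (τ / 2) τ := by
  unfold theta2 jacobiTheta₂ jacobiTheta₂_term
  rw [← tsum_mul_left]
  refine tsum_congr fun n ↦ ?_
  rw [← Complex.exp_add]
  congr 1
  ring

lemma hp_theta3_T (τ : ℂ) : theta3 (τ + 1) = theta4 τ := by
  unfold theta3 theta4
  refine tsum_congr fun n ↦ ?_
  rw [show (Real.pi : ℂ) * I * (τ + 1) * (n : ℂ) ^ 2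
      = (n ^ 2 : ℤ) * (Real.pi * I) + Real.pi * I * τ * (n : ℂ) ^ 2 by push_cast; ring,
    Complex.exp_add, Complex.exp_int_mul, Complex.exp_pi_mul_I]
  congr 1
  rcases Int.even_or_odd n with h | h
  · rw [h.neg_one_zpow, (h.pow_of_ne_zero (by norm_num)).neg_one_zpow]
  · rw [h.neg_one_zpow, (h.pow).neg_one_zpow]

lemma hp_theta4_T (τ : ℂ) : theta4 (τ + 1) = theta3 τ := by
  rw [← hp_theta3_T, hp_theta3_eq, hp_theta3_eq, add_assoc, show (1 : ℂ) + 1 = 2 by norm_num,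
    jacobiTheta₂_add_right]

lemma hp_theta2_T (τ : ℂ) : theta2 (τ + 1) ^ 4 = - theta2 τ ^ 4 := by
  have : theta2 (τ + 1) = cexp ((Real.pi : ℂ) * I / 4) * theta2 τ := by
    unfold theta2
    rw [← tsum_mul_left]
    refine tsum_congr fun n ↦ ?_
    obtain ⟨m, hm⟩ : ∃ m : ℤ, n * (n + 1) = 2 * m := by
      obtain ⟨m, hm⟩ := Int.even_mul_succ_self n
      exact ⟨m, by rw [hm]; ring⟩
    have hm' : (n : ℂ) * (n + 1) = 2 * m := by exact_mod_cast hm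
    rw [show (Real.pi : ℂ) * I * (τ + 1) * (n + 1 / 2) ^ 2
      = (Real.pi * I / 4 + Real.pi * I * τ * (n + 1 / 2) ^ 2) + m * (2 * Real.pi * I) by
        linear_combination (Real.pi : ℂ) * I * hm',
      Complex.exp_add, Complex.exp_int_mul_two_pi_mul_I, mul_one, Complex.exp_add]
  rw [this, mul_pow, ← Complex.exp_nat_mul,
    show ((4 : ℕ) : ℂ) * (Real.pi * I / 4) = Real.pi * I by push_cast; ring, Complex.exp_pi_mul_I]
  ring

lemma hp_s_pow {τ : ℂ} : ((-I * τ) ^ (1 / 2 : ℂ)) ^ 4 = - τ ^ 2 := by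
  have h : ((-I * τ) ^ (1 / 2 : ℂ)) ^ 2 = -I * τ := by
    rw [← Complex.cpow_nat_mul]
    norm_num
  rw [show (4 : ℕ) = 2 * 2 by norm_num, pow_mul, h, mul_pow, neg_sq, I_sq]
  ring

lemma hp_s_ne {τ : ℂ} (h0 : τ ≠ 0) : ((-I * τ) ^ (1 / 2 : ℂ)) ≠ 0 := by
  rw [Ne, Complex.cpow_eq_zero_iff]
  simp [h0]

lemma hp_theta3_S {τ : ℂ} (h0 : τ ≠ 0) : theta3 (-1 / τ) ^ 4 = - τ ^ 2 * theta3 τ ^ 4 := by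
  have := jacobiTheta₂_functional_equation 0 τ
  rw [← hp_s_pow, hp_theta3_eq, hp_theta3_eq, this]
  have hs := hp_s_ne h0
  simp
  field_simp

lemma hp_theta2_S {τ : ℂ} (h0 : τ ≠ 0) : theta2 (-1 / τ) ^ 4 = - τ ^ 2 * theta4 τ ^ 4 := by
  have := jacobiTheta₂_functional_equation (1 / 2) τ
  have hs := hp_s_ne h0
  rw [← hp_s_pow, hp_theta2_eq, hp_theta4_eq, this, ← jacobiTheta₂_neg_left,
    show -(-1 / τ / 2) = 1 / 2 / τ by ring,
    show (Real.pi : ℂ) * I * (-1 / τ) / 4 = -Real.pi * I * (1 / 2) ^ 2 / τ by ring]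
  field_simp

lemma hp_theta4_S {τ : ℂ} (h0 : τ ≠ 0) : theta4 (-1 / τ) ^ 4 = - τ ^ 2 * theta2 τ ^ 4 := by
  have := jacobiTheta₂_functional_equation (τ / 2) τ
  have hs := hp_s_ne h0
  rw [← hp_s_pow, hp_theta2_eq, hp_theta4_eq, this,
    show τ / 2 / τ = 1 / 2 by field_simp,
    show -(Real.pi : ℂ) * I * (τ / 2) ^ 2 / τ = - (Real.pi * I * τ / 4) by field_simp; ring,
    Complex.exp_neg]
  have := Complex.exp_ne_zero (Real.pi * I * τ / 4)
  field_simp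

lemma hp_theta3_diff : DifferentiableOn ℂ theta3 {z | 0 < z.im} := by
  rw [funext hp_theta3_eq]
  exact fun τ hτ ↦ (differentiableAt_jacobiTheta₂_snd 0 hτ).differentiableWithinAt

lemma hp_theta4_diff : DifferentiableOn ℂ theta4 {z | 0 < z.im} := by
  rw [funext hp_theta4_eq]
  exact fun τ hτ ↦ (differentiableAt_jacobiTheta₂_snd _ hτ).differentiableWithinAt

lemma hp_theta2_diff : DifferentiableOn ℂ theta2 {z | 0 < z.im} := by
  rw [funext hp_theta2_eq]
  intro τ hτ
  refine DifferentiableAt.differentiableWithinAt ?_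
  refine DifferentiableAt.mul (by fun_prop) ?_
  have h := (hasFDerivAt_jacobiTheta₂ (τ / 2) hτ).differentiableAt
  exact h.comp (f := fun t : ℂ ↦ (t / 2, t)) τ (by fun_prop)

lemma hp_theta3_lim : Tendsto theta3 (comap Complex.im atTop) (𝓝 1) := by
  have h := isBigO_at_im_infty_jacobiTheta_sub_one
  have h2 : Tendsto (fun τ : ℂ ↦ Real.exp (-Real.pi * τ.im)) (comap Complex.im atTop) (𝓝 0) := by
    refine Real.tendsto_exp_atBot.comp ?_
    exact (tendsto_comap).const_mul_atTop_of_neg (by linarith [Real.pi_pos])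
  have h3 := (h.trans_tendsto h2).add_const 1
  simp only [sub_add_cancel, zero_add] at h3
  refine h3.congr fun τ ↦ ?_
  rw [hp_theta3_eq, jacobiTheta_eq_jacobiTheta₂]

lemma hp_theta4_lim : Tendsto theta4 (comap Complex.im atTop) (𝓝 1) := by
  have : Tendsto (fun τ : ℂ ↦ τ + 1) (comap Complex.im atTop) (comap Complex.im atTop) := by
    rw [tendsto_comap_iff]
    refine tendsto_comap.congr fun τ ↦ ?_
    simp
  exact (hp_theta3_lim.comp this).congr fun τ ↦ hp_theta3_T τ

lemma hp_theta2_lim : Tendsto theta2 (comap Complex.im atTop) (𝓝 0) := by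
  have hn : ∀ (τ : ℂ) (n : ℤ), ‖cexp ((Real.pi : ℂ) * I * τ * ((n : ℂ) + 1 / 2) ^ 2)‖
      = Real.exp (-(Real.pi * ((n : ℝ) + 1 / 2) ^ 2) * τ.im) := by
    intro τ n
    rw [Complex.norm_exp, show (Real.pi : ℂ) * I * τ * ((n : ℂ) + 1 / 2) ^ 2
      = ((Real.pi * ((n : ℝ) + 1 / 2) ^ 2 : ℝ) : ℂ) * (τ * I) by push_cast; ring,
      Complex.re_ofReal_mul]
    simp
  have hsum : Summable fun n : ℤ ↦ Real.exp (-(Real.pi * ((n : ℝ) + 1 / 2) ^ 2) * 1) := by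
    have := ((summable_jacobiTheta₂_term_iff (I / 2) I).mpr (by simp)).norm.mul_left
      (Real.exp (-Real.pi / 4))
    refine this.congr fun n ↦ ?_
    rw [norm_jacobiTheta₂_term, ← Real.exp_add]
    congr 1
    simp
    ring
  have := tendsto_tsum_of_dominated_convergence (𝓕 := comap Complex.im atTop)
    (f := fun (τ : ℂ) (n : ℤ) ↦ cexp ((Real.pi : ℂ) * I * τ * ((n : ℂ) + 1 / 2) ^ 2))
    (g := fun _ ↦ 0) hsum ?_ ?_
  · rw [tsum_zero] at this
    exact this
  · intro n
    rw [tendsto_zero_iff_norm_tendsto_zero]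
    simp_rw [hn]
    refine Real.tendsto_exp_atBot.comp ?_
    refine (tendsto_comap).const_mul_atTop_of_neg ?_
    have : ((n : ℝ) + 1 / 2) ≠ 0 := by
      intro h
      have h2 : (2 * n + 1 : ℝ) = 0 := by linarith
      have h3 : (2 * n + 1 : ℤ) = 0 := by exact_mod_cast h2
      omega
    have := Real.pi_pos
    have : 0 < Real.pi * ((n : ℝ) + 1 / 2) ^ 2 := by positivity
    linarith
  · have : ∀ᶠ τ : ℂ in comap Complex.im atTop, 1 ≤ τ.im :=
      tendsto_comap.eventually (eventually_ge_atTop 1)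
    filter_upwards [this] with τ hτ n
    rw [hn]
    apply Real.exp_le_exp.mpr
    have : 0 ≤ Real.pi * ((n : ℝ) + 1 / 2) ^ 2 := by have := Real.pi_pos; positivity
    nlinarith
end PartB
section PartC

/-- Sum over one row of the lattice. -/
noncomputable def hpF (z : ℂ) : ℂ := ∑' n : ℤ, 1 / (z + n) ^ 2

lemma hpF_summable (z : ℂ) : Summable fun n : ℤ ↦ 1 / (z + n) ^ 2 := by
  have := EisensteinSeries.linear_right_summable z 1 (k := 2) le_rfl
  refine this.congr fun n ↦ ?_
  simp

lemma hpF_add_int (z : ℂ) (m : ℤ) : hpF (z + m) = hpF z := by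
  unfold hpF
  rw [← (Equiv.addLeft m).tsum_eq (fun n : ℤ ↦ 1 / (z + n) ^ 2)]
  refine tsum_congr fun n ↦ ?_
  simp [add_assoc]

lemma hpF_add_one (z : ℂ) : hpF (z + 1) = hpF z := by
  simpa using hpF_add_int z 1

lemma hpF_neg (z : ℂ) : hpF (-z) = hpF z := by
  unfold hpF
  rw [← (Equiv.neg ℤ).tsum_eq (fun n : ℤ ↦ 1 / (z + n) ^ 2)]
  refine tsum_congr fun n ↦ ?_
  simp only [Equiv.neg_apply, Int.cast_neg]
  rw [show -z + (n : ℂ) = -(z + -n) by ring, neg_sq]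

lemma hp_exp_norm (z : ℂ) : ‖cexp (2 * Real.pi * I * z)‖ = Real.exp (-(2 * (Real.pi * z.im))) := by
  rw [Complex.norm_exp]
  congr 1
  rw [show 2 * (Real.pi : ℂ) * I * z = ((2 * Real.pi : ℝ) : ℂ) * (z * I) by push_cast; ring,
    Complex.re_ofReal_mul]
  simp
  ring

lemma hp_exp_norm_lt {z : ℂ} (hz : 0 < z.im) : ‖cexp (2 * Real.pi * I * z)‖ < 1 := by
  rw [hp_exp_norm, Real.exp_lt_one_iff]
  have := Real.pi_pos
  have : 0 < Real.pi * z.im := by positivity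
  linarith

lemma hpF_eq {z : ℂ} (hz : 0 < z.im) : hpF z =
    -4 * (Real.pi : ℂ) ^ 2 *
      (cexp (2 * Real.pi * I * z) / (1 - cexp (2 * Real.pi * I * z)) ^ 2) := by
  have := EisensteinSeries.qExpansion_identity (k := 1) le_rfl ⟨z, hz⟩
  simp only [Nat.reduceAdd, pow_one] at this
  unfold hpF
  erw [this]
  erw [tsum_coe_mul_geometric_of_norm_lt_one (hp_exp_norm_lt hz)]
  simp only [Nat.factorial_one, Nat.cast_one, div_one]
  congr 1
  rw [mul_pow, I_sq]
  ring

lemma hpF_bound_pos {z : ℂ} (hz : 0 < z.im) : ‖hpF z‖ ≤ 1 / z.im ^ 2 := by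
  rw [hpF_eq hz]
  have h1 := hp_exp_norm_lt hz
  have h2 := hp_exp_norm z
  set w := cexp (2 * Real.pi * I * z)
  have hx : 0 < Real.pi * z.im := mul_pos Real.pi_pos hz
  have hs : Real.pi * z.im ≤ Real.sinh (Real.pi * z.im) := Real.self_le_sinh_iff.mpr hx.le
  rw [Real.sinh_eq] at hs
  have hw : 1 - ‖w‖ ≤ ‖1 - w‖ := by
    have := norm_sub_norm_le (1 : ℂ) w
    simpa using this
  have hpos : 0 < 1 - ‖w‖ := by linarith
  set e := Real.exp (-(Real.pi * z.im)) with he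
  have hepos : 0 < e := Real.exp_pos _
  have hwe : ‖w‖ = e ^ 2 := by
    rw [h2, he, ← Real.exp_nat_mul]
    congr 1
    push_cast
    ring
  have hinv : Real.exp (Real.pi * z.im) * e = 1 := by
    rw [he, ← Real.exp_add]; simp
  have hkey : 2 * (Real.pi * z.im) * e ≤ 1 - ‖w‖ := by
    rw [hwe]
    nlinarith
  have hkey2 : (2 * (Real.pi * z.im) * e) ^ 2 ≤ ‖1 - w‖ ^ 2 :=
    pow_le_pow_left₀ (by positivity) (hkey.trans hw) 2
  have hpos2 : 0 < ‖1 - w‖ := by linarith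
  rw [norm_mul, norm_div, norm_pow, hwe]
  have : ‖-4 * (Real.pi : ℂ) ^ 2‖ = 4 * Real.pi ^ 2 := by
    simp
  rw [this, ← mul_div_assoc, div_le_div_iff₀ (by positivity) (by positivity)]
  linarith

lemma hpF_bound {z : ℂ} (hz : z.im ≠ 0) : ‖hpF z‖ ≤ 1 / z.im ^ 2 := by
  rcases lt_or_gt_of_ne hz with h | h
  · rw [← hpF_neg]
    have := hpF_bound_pos (z := -z) (by simpa using h)
    simpa using this
  · exact hpF_bound_pos h

lemma hpF_diff_pos {z : ℂ} (hz : 0 < z.im) : DifferentiableAt ℂ hpF z := by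
  have : hpF =ᶠ[𝓝 z] fun z ↦ -4 * (Real.pi : ℂ) ^ 2 *
      (cexp (2 * Real.pi * I * z) / (1 - cexp (2 * Real.pi * I * z)) ^ 2) := by
    filter_upwards [(isOpen_lt continuous_const Complex.continuous_im).mem_nhds hz] with w hw
    exact hpF_eq hw
  refine DifferentiableAt.congr_of_eventuallyEq ?_ this
  refine DifferentiableAt.const_mul ?_ _
  refine DifferentiableAt.div (by fun_prop) (by fun_prop) ?_
  refine pow_ne_zero _ ?_
  intro h
  have h1 := hp_exp_norm_lt hz
  rw [← sub_eq_zero.mp h] at h1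
  simp at h1

lemma hpF_diff {z : ℂ} (hz : z.im ≠ 0) : DifferentiableAt ℂ hpF z := by
  rcases lt_or_gt_of_ne hz with h | h
  · have h1 := hpF_diff_pos (z := -z) (by simpa using h)
    have h2 : hpF = hpF ∘ (fun z ↦ -z) := by
      ext z; simp [hpF_neg]
    rw [h2]
    exact DifferentiableAt.comp z h1 (by fun_prop)
  · exact hpF_diff_pos h

lemma hpF_zero : hpF 0 = (Real.pi : ℂ) ^ 2 / 3 := by
  have h := hasSum_zeta_two
  have h' : HasSum (fun n : ℕ ↦ 1 / ((n : ℂ)) ^ 2) ((Real.pi : ℂ) ^ 2 / 6) := by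
    have := Complex.hasSum_ofReal.mpr h
    simpa using this
  have h2 : HasSum (fun n : ℤ ↦ 1 / ((n : ℂ)) ^ 2) ((Real.pi : ℂ) ^ 2 / 6 + Real.pi ^ 2 / 6 - 1 / ((0 : ℤ) : ℂ) ^ 2) := by
    refine HasSum.of_nat_of_neg (f := fun n : ℤ ↦ 1 / ((n : ℂ)) ^ 2) ?_ ?_
    · simpa using h'
    · simpa using h'
  unfold hpF
  simp only [zero_add]
  rw [h2.tsum_eq]
  simp
  ring

lemma hp_int_even_add_odd {f : ℤ → ℂ} {a b : ℂ} (he : HasSum (fun n : ℤ ↦ f (2 * n)) a)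
    (ho : HasSum (fun n : ℤ ↦ f (2 * n + 1)) b) : HasSum f (a + b) := by
  have h2 : Function.Injective (fun n : ℤ ↦ 2 * n) := fun a b h ↦ by
    simp only at h; omega
  have h3 : Function.Injective (fun n : ℤ ↦ 2 * n + 1) := fun a b h ↦ by
    simp only at h; omega
  have he' := h2.hasSum_range_iff.2 he
  have ho' := h3.hasSum_range_iff.2 ho
  refine HasSum.add_isCompl ?_ he' ho'
  have h := Int.isCompl_even_odd
  have e1 : Set.range (fun n : ℤ ↦ 2 * n) = {n : ℤ | Even n} := by
    ext n; simp only [Set.mem_range, Set.mem_ofPred_eq]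
    rw [even_iff_two_dvd]
    exact ⟨fun ⟨y, hy⟩ ↦ ⟨y, hy.symm⟩, fun ⟨y, hy⟩ ↦ ⟨y, hy.symm⟩⟩
  have e2 : Set.range (fun n : ℤ ↦ 2 * n + 1) = {n : ℤ | Odd n} := by
    ext n; simp only [Set.mem_range, Set.mem_ofPred_eq]
    exact ⟨fun ⟨y, hy⟩ ↦ ⟨y, hy.symm⟩, fun ⟨y, hy⟩ ↦ ⟨y, hy.symm⟩⟩
  rw [e1, e2]
  exact h

lemma hpF_half : hpF (1 / 2) = (Real.pi : ℂ) ^ 2 := by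
  have h0 := hpF_summable 0
  have hz := hpF_zero
  simp only [hpF, zero_add] at h0 hz
  have he : HasSum (fun n : ℤ ↦ 1 / (((2 * n : ℤ) : ℂ)) ^ 2) (1 / 4 * ((Real.pi : ℂ) ^ 2 / 3)) := by
    have := h0.hasSum.mul_left (1 / 4)
    rw [hz] at this
    refine this.congr_fun fun n ↦ ?_
    push_cast
    rw [one_div, one_div, one_div, mul_pow, mul_inv]
    norm_num
  have ho : HasSum (fun n : ℤ ↦ 1 / (((2 * n + 1 : ℤ) : ℂ)) ^ 2) (1 / 4 * hpF (1 / 2)) := by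
    have := (hpF_summable (1 / 2)).hasSum.mul_left (1 / 4)
    refine this.congr_fun fun n ↦ ?_
    push_cast
    rw [show (2 * (n : ℂ) + 1) = 2 * (1 / 2 + n) by ring, mul_pow, one_div, mul_inv]
    ring
  have := (hp_int_even_add_odd (f := fun n : ℤ ↦ 1 / ((n : ℂ)) ^ 2) he ho).tsum_eq
  rw [hz] at this
  linear_combination -4 * this

end PartC

section PartD

lemma hp_indep {τ : ℂ} (hτ : 0 < τ.im) : LinearIndependent ℝ ![τ, (1 : ℂ)] := by
  rw [LinearIndependent.pair_iff]
  intro s t h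
  have h1 := congrArg Complex.im h
  have h2 := congrArg Complex.re h
  simp at h1 h2
  have hs : s = 0 := h1.resolve_right hτ.ne'
  subst hs
  simpa using h2

lemma hp_wp_summable {τ : ℂ} (hτ : 0 < τ.im) (u : ℂ) : Summable fun p : ℤ × ℤ ↦
    1 / (u + (p.1 : ℂ) * τ + (p.2 : ℂ)) ^ 2 - 1 / ((p.1 : ℂ) * τ + (p.2 : ℂ)) ^ 2 := by
  let L : PeriodPair := ⟨τ, 1, hp_indep hτ⟩
  have h := (L.hasSum_weierstrassP (-u)).summable
  have h2 := (L.latticeEquivProd.symm.toEquiv.summable_iff).mpr h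
  refine h2.congr fun p ↦ ?_
  have := L.latticeEquiv_symm_apply p
  simp only [Function.comp_apply, LinearEquiv.coe_toEquiv]
  rw [this]
  change 1 / (-u - (p.1 * τ + p.2 * 1)) ^ 2 - 1 / (p.1 * τ + p.2 * 1) ^ 2 = _
  rw [mul_one, show -u - (p.1 * τ + p.2) = -(u + p.1 * τ + p.2) by ring, neg_sq]

lemma hp_wp_eq {τ : ℂ} (hτ : 0 < τ.im) (u : ℂ) : wp τ u = ∑' p : ℤ × ℤ,
    (1 / (u + (p.1 : ℂ) * τ + (p.2 : ℂ)) ^ 2 - 1 / ((p.1 : ℂ) * τ + (p.2 : ℂ)) ^ 2) := by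
  rw [(hp_wp_summable hτ u).tsum_eq_add_tsum_ite 0]
  unfold wp
  congr 1
  · simp

lemma hp_wp_rows {τ : ℂ} (hτ : 0 < τ.im) (u : ℂ) :
    wp τ u = ∑' m : ℤ, (hpF (u + m * τ) - hpF (m * τ)) := by
  rw [hp_wp_eq hτ]
  refine ((hp_wp_summable hτ u).tsum_prod).trans (tsum_congr fun m ↦ ?_)
  exact (hpF_summable (u + m * τ)).tsum_sub (hpF_summable (m * τ))

lemma hp_wp_add_one {τ : ℂ} (hτ : 0 < τ.im) (u : ℂ) : wp τ (u + 1) = wp τ u := by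
  rw [hp_wp_rows hτ, hp_wp_rows hτ]
  refine tsum_congr fun m ↦ ?_
  rw [show u + 1 + m * τ = u + m * τ + 1 by ring, hpF_add_one]

lemma hp_wp_T {τ : ℂ} (hτ : 0 < τ.im) (u : ℂ) : wp (τ + 1) u = wp τ u := by
  rw [hp_wp_rows hτ, hp_wp_rows (by simpa using hτ)]
  refine tsum_congr fun m ↦ ?_
  rw [show u + m * (τ + 1) = u + m * τ + m by ring, show m * (τ + 1) = m * τ + m by ring,
    hpF_add_int, hpF_add_int]

lemma hp_S_im {τ : ℂ} (hτ : 0 < τ.im) : 0 < (-1 / τ).im := by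
  have h0 : τ ≠ 0 := by rintro rfl; simp at hτ
  rw [neg_div, one_div, Complex.neg_im, Complex.inv_im]
  have := Complex.normSq_pos.mpr h0
  rw [neg_div, neg_neg]
  positivity

lemma hp_wp_S {τ : ℂ} (hτ : 0 < τ.im) (u : ℂ) : wp (-1 / τ) (u / τ) = τ ^ 2 * wp τ u := by
  have h0 : τ ≠ 0 := by rintro rfl; simp at hτ
  let e : ℤ × ℤ ≃ ℤ × ℤ :=
    { toFun := fun p ↦ (-p.2, p.1)
      invFun := fun p ↦ (p.2, -p.1)
      left_inv := fun p ↦ by simp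
      right_inv := fun p ↦ by simp }
  rw [hp_wp_eq hτ, hp_wp_eq (hp_S_im hτ), ← tsum_mul_left, ← e.tsum_eq]
  refine tsum_congr fun p ↦ ?_
  simp only [e, Equiv.coe_fn_mk]
  push_cast
  rw [show u / τ + -(p.2 : ℂ) * (-1 / τ) + p.1 = (u + p.1 * τ + p.2) / τ by field_simp; ring,
    show -(p.2 : ℂ) * (-1 / τ) + p.1 = (p.1 * τ + p.2) / τ by field_simp; ring,
    div_pow, div_pow, one_div_div, one_div_div]
  ring

/-- Row sums over a shifted lattice. -/
noncomputable def hpH (a b : ℝ) (τ : ℂ) : ℂ := ∑' m : ℤ, hpF ((m + a) * τ + b)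

/-- Dominating sequence. -/
noncomputable def hpBd (a b c : ℝ) (m : ℤ) : ℝ :=
  1 / ((m + a) ^ 2) * (1 / c ^ 2) + if (m : ℝ) = -a then ‖hpF b‖ else 0

lemma hpBd_summable (a b c : ℝ) : Summable (hpBd a b c) := by
  refine Summable.add ?_ ?_
  · have := (Real.summable_one_div_int_add_rpow a 2).mpr (by norm_num)
    refine Summable.mul_right _ (this.congr fun m ↦ ?_)
    norm_cast
    simp
  · refine summable_of_hasFiniteSupport ?_
    refine Set.Finite.subset (Set.finite_singleton ⌊-a⌋) ?_
    intro m hm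
    rw [Function.mem_support] at hm
    by_cases h : (m : ℝ) = -a
    · rw [Set.mem_singleton_iff, ← h]; simp
    · simp [h] at hm

lemma hp_im (a b : ℝ) (m : ℤ) (τ : ℂ) : (((m : ℂ) + a) * τ + b).im = (m + a) * τ.im := by
  simp

lemma hpBd_bound (a b : ℝ) {c : ℝ} (hc : 0 < c) {τ : ℂ} (hτ : c ≤ τ.im) (m : ℤ) :
    ‖hpF ((m + a) * τ + b)‖ ≤ hpBd a b c m := by
  unfold hpBd
  by_cases h : (m : ℝ) = -a
  · have : (m : ℂ) = -a := by exact_mod_cast h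
    rw [if_pos h, this, h]
    simp
  · rw [if_neg h, add_zero]
    have h1 : (m : ℝ) + a ≠ 0 := fun h' ↦ h (by linarith)
    have hp : 0 < τ.im := hc.trans_le hτ
    refine (hpF_bound ?_).trans ?_
    · rw [hp_im]; exact mul_ne_zero h1 hp.ne'
    · rw [hp_im, mul_pow, one_div_mul_one_div]
      have : 0 < ((m : ℝ) + a) ^ 2 := by positivity
      gcongr

lemma hpH_summable (a b : ℝ) {τ : ℂ} (hτ : 0 < τ.im) :
    Summable fun m : ℤ ↦ hpF ((m + a) * τ + b) :=
  Summable.of_norm_bounded (hpBd_summable a b τ.im) (hpBd_bound a b hτ le_rfl)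

lemma hp_wp_H (a b : ℝ) {τ : ℂ} (hτ : 0 < τ.im) :
    wp τ (a * τ + b) = hpH a b τ - hpH 0 0 τ := by
  rw [hp_wp_rows hτ]
  unfold hpH
  rw [← (hpH_summable a b hτ).tsum_sub (hpH_summable 0 0 hτ)]
  refine tsum_congr fun m ↦ ?_
  congr 2
  · ring
  · simp

lemma hpH_diff (a b : ℝ) : DifferentiableOn ℂ (hpH a b) {z | 0 < z.im} := by
  intro τ hτ
  have hτ' : 0 < τ.im := hτ
  have hU : IsOpen {z : ℂ | τ.im / 2 < z.im} := isOpen_lt continuous_const Complex.continuous_im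
  have h := differentiableOn_tsum_of_summable_norm (F := fun (m : ℤ) (τ : ℂ) ↦ hpF ((m + a) * τ + b))
    (hpBd_summable a b (τ.im / 2)) (U := {z : ℂ | τ.im / 2 < z.im}) ?_ hU ?_
  · exact ((h τ (show τ.im / 2 < τ.im by linarith)).differentiableAt
      (hU.mem_nhds (show τ.im / 2 < τ.im by linarith))).differentiableWithinAt
  · intro m w hw
    have hw' : τ.im / 2 < w.im := hw
    refine DifferentiableAt.differentiableWithinAt ?_
    by_cases hm : (m : ℝ) + a = 0
    · have : (m : ℂ) + a = 0 := by exact_mod_cast hm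
      simp [this]
    · refine DifferentiableAt.comp w (hpF_diff ?_) (by fun_prop)
      rw [hp_im]
      exact mul_ne_zero hm (by linarith)
  · intro m w hw
    have hw' : τ.im / 2 < w.im := hw
    exact hpBd_bound a b (by linarith) hw'.le m

lemma hpH_lim (a b : ℝ) : Tendsto (hpH a b) (comap Complex.im atTop)
    (𝓝 (∑' m : ℤ, if (m : ℝ) + a = 0 then hpF b else 0)) := by
  refine tendsto_tsum_of_dominated_convergence (hpBd_summable a b 1) ?_ ?_
  · intro m
    by_cases hm : (m : ℝ) + a = 0
    · have : (m : ℂ) + a = 0 := by exact_mod_cast hm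
      simp only [this, hm, if_true, zero_mul, zero_add]
      exact tendsto_const_nhds
    · simp only [hm, if_false]
      have him : Tendsto (fun z : ℂ ↦ z.im) (comap Complex.im atTop) atTop := tendsto_comap
      have h2 : Tendsto (fun z : ℂ ↦ 1 / (((m : ℝ) + a) ^ 2 * z.im ^ 2)) (comap Complex.im atTop)
          (𝓝 0) := by
        simp only [one_div]
        refine Tendsto.inv_tendsto_atTop ?_
        refine Tendsto.const_mul_atTop (by positivity) ?_
        exact (tendsto_pow_atTop two_ne_zero).comp him
      refine squeeze_zero_norm' ?_ h2
      filter_upwards [him.eventually_gt_atTop 0] with z hz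
      have := hpF_bound (z := (m + a) * z + b) (by rw [hp_im]; exact mul_ne_zero hm hz.ne')
      rwa [hp_im, mul_pow] at this
  · have him : Tendsto (fun z : ℂ ↦ z.im) (comap Complex.im atTop) atTop := tendsto_comap
    filter_upwards [him.eventually_ge_atTop 1] with z hz
    exact hpBd_bound a b one_pos hz

lemma hpH_lim_zero (b : ℝ) : Tendsto (hpH 0 b) (comap Complex.im atTop) (𝓝 (hpF b)) := by
  have := hpH_lim 0 b
  simpa [tsum_ite_eq] using this

lemma hpH_lim_half (b : ℝ) : Tendsto (hpH (1 / 2) b) (comap Complex.im atTop) (𝓝 0) := by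
  have := hpH_lim (1 / 2) b
  have h : ∀ m : ℤ, (m : ℝ) + 1 / 2 ≠ 0 := by
    intro m hm
    have h2 : (2 * m + 1 : ℝ) = 0 := by linarith
    have h3 : (2 * m + 1 : ℤ) = 0 := by exact_mod_cast h2
    omega
  simpa only [h, if_false, tsum_zero] using this

lemma hp_e1 {τ : ℂ} (hτ : 0 < τ.im) : wp τ (1 / 2) = hpH 0 (1 / 2) τ - hpH 0 0 τ := by
  rw [← hp_wp_H 0 (1 / 2) hτ]; congr 1; push_cast; ring

lemma hp_e2 {τ : ℂ} (hτ : 0 < τ.im) : wp τ (τ / 2) = hpH (1 / 2) 0 τ - hpH 0 0 τ := by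
  rw [← hp_wp_H (1 / 2) 0 hτ]; congr 1; push_cast; ring

lemma hp_e3 {τ : ℂ} (hτ : 0 < τ.im) :
    wp τ ((1 + τ) / 2) = hpH (1 / 2) (1 / 2) τ - hpH 0 0 τ := by
  rw [← hp_wp_H (1 / 2) (1 / 2) hτ]; congr 1; push_cast; ring

lemma hp_ev : ∀ᶠ z : ℂ in comap Complex.im atTop, 0 < z.im := by
  have him : Tendsto (fun z : ℂ ↦ z.im) (comap Complex.im atTop) atTop := tendsto_comap
  exact him.eventually_gt_atTop 0

end PartD

section PartE

lemma hp_main (τ : ℂ) (hτ : 0 < τ.im) :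
    wp τ (1 / 2) - (Real.pi : ℂ) ^ 2 / 3 * (theta3 τ ^ 4 + theta4 τ ^ 4) = 0 ∧
    wp τ (τ / 2) + (Real.pi : ℂ) ^ 2 / 3 * (theta2 τ ^ 4 + theta3 τ ^ 4) = 0 ∧
    wp τ ((1 + τ) / 2) - (Real.pi : ℂ) ^ 2 / 3 * (theta2 τ ^ 4 - theta4 τ ^ 4) = 0 := by
  have h0 : ∀ {τ : ℂ}, 0 < τ.im → τ ≠ 0 := by
    rintro τ h rfl
    simp at h
  have l2 := hp_theta2_lim.pow 4
  have l3 := hp_theta3_lim.pow 4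
  have l4 := hp_theta4_lim.pow 4
  have d2 := hp_theta2_diff.fun_pow 4
  have d3 := hp_theta3_diff.fun_pow 4
  have d4 := hp_theta4_diff.fun_pow 4
  have m00 := hpH_lim_zero 0
  have m01 := hpH_lim_zero (1 / 2)
  have m10 := hpH_lim_half 0
  have m11 := hpH_lim_half (1 / 2)
  rw [Complex.ofReal_zero, hpF_zero] at m00
  rw [show (((1 / 2 : ℝ)) : ℂ) = 1 / 2 by push_cast; rfl, hpF_half] at m01
  refine hp_triple_zero
    (fun τ ↦ wp τ (1 / 2) - (Real.pi : ℂ) ^ 2 / 3 * (theta3 τ ^ 4 + theta4 τ ^ 4))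
    (fun τ ↦ wp τ (τ / 2) + (Real.pi : ℂ) ^ 2 / 3 * (theta2 τ ^ 4 + theta3 τ ^ 4))
    (fun τ ↦ wp τ ((1 + τ) / 2) - (Real.pi : ℂ) ^ 2 / 3 * (theta2 τ ^ 4 - theta4 τ ^ 4))
    ?_ ?_ ?_ ?_ ?_ ?_ ?_ ?_ ?_ ?_ ?_ ?_ τ hτ
  · refine DifferentiableOn.fun_sub ?_ ((d3.fun_add d4).const_mul _)
    exact ((hpH_diff 0 (1 / 2)).sub (hpH_diff 0 0)).congr fun τ hτ ↦ hp_e1 hτ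
  · refine DifferentiableOn.fun_add ?_ ((d2.fun_add d3).const_mul _)
    exact ((hpH_diff (1 / 2) 0).sub (hpH_diff 0 0)).congr fun τ hτ ↦ hp_e2 hτ
  · refine DifferentiableOn.fun_sub ?_ ((d2.fun_sub d4).const_mul _)
    exact ((hpH_diff (1 / 2) (1 / 2)).sub (hpH_diff 0 0)).congr fun τ hτ ↦ hp_e3 hτ
  · have h := (m01.sub m00).sub ((l3.add l4).const_mul ((Real.pi : ℂ) ^ 2 / 3))
    rw [show (Real.pi : ℂ) ^ 2 - Real.pi ^ 2 / 3 - Real.pi ^ 2 / 3 * (1 ^ 4 + 1 ^ 4) = 0 by ring] at h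
    refine h.congr' ?_
    filter_upwards [hp_ev] with z hz
    rw [hp_e1 hz]
  · have h := (m10.sub m00).add ((l2.add l3).const_mul ((Real.pi : ℂ) ^ 2 / 3))
    rw [show 0 - (Real.pi : ℂ) ^ 2 / 3 + Real.pi ^ 2 / 3 * (0 ^ 4 + 1 ^ 4) = 0 by ring] at h
    refine h.congr' ?_
    filter_upwards [hp_ev] with z hz
    rw [hp_e2 hz]
  · have h := (m11.sub m00).sub ((l2.sub l4).const_mul ((Real.pi : ℂ) ^ 2 / 3))
    rw [show 0 - (Real.pi : ℂ) ^ 2 / 3 - Real.pi ^ 2 / 3 * (0 ^ 4 - 1 ^ 4) = 0 by ring] at h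
    refine h.congr' ?_
    filter_upwards [hp_ev] with z hz
    rw [hp_e3 hz]
  · intro τ hτ
    rw [hp_wp_T hτ, hp_theta3_T, hp_theta4_T]
    ring
  · intro τ hτ
    rw [hp_wp_T hτ, hp_theta3_T, hp_theta2_T, add_comm τ 1]
    ring
  · intro τ hτ
    rw [hp_wp_T hτ, hp_theta4_T, hp_theta2_T, show (1 + (τ + 1)) / 2 = τ / 2 + 1 by ring,
      hp_wp_add_one hτ]
    ring
  · intro τ hτ
    have hn := h0 hτ
    rw [hp_theta3_S hn, hp_theta4_S hn, show (1 / 2 : ℂ) = (τ / 2) / τ by field_simp, hp_wp_S hτ]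
    ring
  · intro τ hτ
    have hn := h0 hτ
    rw [hp_theta3_S hn, hp_theta2_S hn, show -1 / τ / 2 = (-1 / 2) / τ by field_simp, hp_wp_S hτ,
      ← hp_wp_add_one hτ, show (-1 / 2 + 1 : ℂ) = 1 / 2 by norm_num]
    ring
  · intro τ hτ
    have hn := h0 hτ
    rw [hp_theta2_S hn, hp_theta4_S hn,
      show (1 + -1 / τ) / 2 = ((-1 + τ) / 2) / τ by field_simp; ring, hp_wp_S hτ,
      ← hp_wp_add_one hτ, show ((-1 + τ) / 2 + 1 : ℂ) = (1 + τ) / 2 by ring]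
    ring

end PartE

end HalfPeriodProof

/-- The half-period values of `℘` in terms of theta constants:
`℘(1/2, τ) = (π²/3)(θ₃⁴ + θ₄⁴)`, `℘(τ/2, τ) = -(π²/3)(θ₂⁴ + θ₃⁴)`,
`℘((1+τ)/2, τ) = (π²/3)(θ₂⁴ - θ₄⁴)`. -/
theorem half_period_values_eq_theta_constants (τ : ℂ) (hτ : 0 < τ.im) :
    wp τ (1 / 2) = (Real.pi : ℂ) ^ 2 / 3 * (theta3 τ ^ 4 + theta4 τ ^ 4) ∧
    wp τ (τ / 2) = -((Real.pi : ℂ) ^ 2 / 3) * (theta2 τ ^ 4 + theta3 τ ^ 4) ∧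
    wp τ ((1 + τ) / 2) = (Real.pi : ℂ) ^ 2 / 3 * (theta2 τ ^ 4 - theta4 τ ^ 4) := by
  obtain ⟨h1, h2, h3⟩ := hp_main τ hτ
  refine ⟨sub_eq_zero.mp h1, ?_, sub_eq_zero.mp h3⟩
  rw [neg_mul]
  exact eq_neg_of_add_eq_zero_left h2
end
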